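/- Let β ∈ (−1, 1), μ₊, μ₋ ∈ ℝ, q > 0 and y > 0. Then ∫₀^∞ e^{−q t} · [ 2(1+β) e^{2 μ₊ y} ∫₀^∞ ∫₀^t h(t − τ; (1+β) b + y, μ₊) · h(τ; (1−β) b, −μ₋) dτ db ] dt = (2(1+β)/D(q)) · e^{(μ₊ − √(2q + μ₊²)) y}. -/

import Mathlib

open MeasureTheory Real Set Filter

/-- The auxiliary density `h(t; x, μ) = |x| / √(2π t³) · exp(−(x + μ t)² / (2t))`. -/
noncomputable def h (t x μ : ℝ) : ℝ :=
  |x| / Real.sqrt (2 * Real.pi * t ^ 3) * Real.exp (-(x + μ * t) ^ 2 / (2 * t))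

/-- `D(q) = (1+β)(μ₊ + √(2q+μ₊²)) + (1−β)(−μ₋ + √(2q+μ₋²))`. -/
noncomputable def D (β μp μm q : ℝ) : ℝ :=
  (1 + β) * (μp + Real.sqrt (2 * q + μp ^ 2)) + (1 - β) * (-μm + Real.sqrt (2 * q + μm ^ 2))

open scoped Topology

/-- Fundamental theorem of calculus on `(a, ∞)` for a nonnegative derivative, where the
antiderivative is only assumed to have a right limit at `a`. -/
theorem integrableOn_and_integral_Ioi_of_hasDerivAt_of_nonneg {g g' : ℝ → ℝ} {a m l : ℝ}
    (ha : Tendsto g (𝓝[>] a) (𝓝 m)) (hderiv : ∀ x ∈ Ioi a, HasDerivAt g (g' x) x)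
    (g'pos : ∀ x ∈ Ioi a, 0 ≤ g' x) (hg : Tendsto g atTop (𝓝 l)) :
    IntegrableOn g' (Ioi a) ∧ ∫ x in Ioi a, g' x = l - m := by
  have hcont : ContinuousWithinAt (Function.update g a m) (Ici a) a := by
    rw [continuousWithinAt_update_same, Ici_sdiff_left]
    exact ha
  have hd : ∀ x ∈ Ioi a, HasDerivAt (Function.update g a m) (g' x) x := fun x hx =>
    (hderiv x hx).congr_of_eventuallyEq <| by
      filter_upwards [eventually_ne_nhds (ne_of_gt hx)] with z hz
      exact Function.update_of_ne hz _ _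
  have hlim : Tendsto (Function.update g a m) atTop (𝓝 l) := hg.congr' <| by
    filter_upwards [eventually_ne_atTop a] with z hz
    exact (Function.update_of_ne hz _ _).symm
  refine ⟨integrableOn_Ioi_deriv_of_nonneg hcont hd g'pos hlim, ?_⟩
  simpa using integral_Ioi_of_hasDerivAt_of_nonneg hcont hd g'pos hlim

theorem hasDerivAt_integral_exp_neg_sq (u : ℝ) :
    HasDerivAt (fun u : ℝ => ∫ v in (0 : ℝ)..u, exp (-v ^ 2)) (exp (-u ^ 2)) u := by
  have hc : Continuous fun v : ℝ => exp (-v ^ 2) := by fun_prop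
  exact intervalIntegral.integral_hasDerivAt_right (hc.intervalIntegrable _ _)
    hc.stronglyMeasurable.stronglyMeasurableAtFilter hc.continuousAt

theorem tendsto_integral_exp_neg_sq_atTop :
    Tendsto (fun u : ℝ => ∫ v in (0 : ℝ)..u, exp (-v ^ 2)) atTop (𝓝 (√π / 2)) := by
  have h1 := integral_gaussian_Ioi 1
  simp only [div_one, neg_mul, one_mul] at h1
  rw [← h1]
  refine intervalIntegral_tendsto_integral_Ioi 0 ?_ tendsto_id
  simpa using (integrable_exp_neg_mul_sq one_pos).integrableOn

theorem tendsto_integral_exp_neg_sq_atBot :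
    Tendsto (fun u : ℝ => ∫ v in (0 : ℝ)..u, exp (-v ^ 2)) atBot (𝓝 (-(√π / 2))) := by
  refine (tendsto_integral_exp_neg_sq_atTop.comp tendsto_neg_atBot_atTop).neg.congr fun u => ?_
  have := intervalIntegral.integral_comp_neg (a := 0) (b := u) fun v : ℝ => exp (-v ^ 2)
  simp only [neg_sq, neg_zero] at this
  rw [this, intervalIntegral.integral_symm, Function.comp_apply]

theorem h_nonneg (t x μ : ℝ) : 0 ≤ h t x μ := by
  unfold h
  positivity

theorem exp_mul_h {q t x μ s : ℝ} (ht : 0 < t) (hx : 0 < x) (hs : s ^ 2 = 2 * q + μ ^ 2) :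
    exp (-q * t) * h t x μ = exp (-(x * (μ + s))) / √π *
      (exp (-((s * t - x) / √(2 * t)) ^ 2) * (2 * x / √(2 * t) ^ 3)) := by
  have hr : 0 < √(2 * t) := by positivity
  have hr2 : √(2 * t) ^ 2 = 2 * t := sq_sqrt (by positivity)
  have hsq : √(2 * π * t ^ 3) = √π * √(2 * t) ^ 3 / 2 := by
    rw [sqrt_eq_iff_mul_self_eq_of_pos (by positivity)]
    have hp : √π ^ 2 = π := sq_sqrt pi_pos.le
    calc _ = √π ^ 2 * (√(2 * t) ^ 2) ^ 3 / 4 := by ring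
      _ = _ := by rw [hp, hr2]; ring
  have hexp : exp (-q * t) * exp (-(x + μ * t) ^ 2 / (2 * t)) =
      exp (-(x * (μ + s))) * exp (-((s * t - x) / √(2 * t)) ^ 2) := by
    rw [← exp_add, ← exp_add, div_pow, hr2]
    congr 1
    field_simp
    linear_combination t ^ 2 * hs
  rw [h, hsq, abs_of_pos hx]
  calc _ = exp (-q * t) * exp (-(x + μ * t) ^ 2 / (2 * t)) *
        (x / (√π * √(2 * t) ^ 3 / 2)) := by ring
    _ = _ := by rw [hexp]; field_simp

/-- The antiderivative is the (unnormalised) distribution function of the inverse Gaussian law. -/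
theorem hasDerivAt_inverseGaussian {s x t : ℝ} (ht : 0 < t) :
    HasDerivAt (fun t => (∫ v in (0 : ℝ)..((s * t - x) / √(2 * t)), exp (-v ^ 2)) -
        exp (2 * s * x) * ∫ v in (0 : ℝ)..((s * t + x) / √(2 * t)), exp (-v ^ 2))
      (exp (-((s * t - x) / √(2 * t)) ^ 2) * (2 * x / √(2 * t) ^ 3)) t := by
  have hr : 0 < √(2 * t) := by positivity
  have hr2 : √(2 * t) ^ 2 = 2 * t := sq_sqrt (by positivity)
  have hdr : HasDerivAt (fun t : ℝ => √(2 * t)) (1 / √(2 * t)) t := by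
    convert! ((hasDerivAt_id t).const_mul 2).sqrt (by simpa using ht.ne') using 1
    simp only [id]
    field_simp
  have hd (c : ℝ) : HasDerivAt (fun t => (s * t + c) / √(2 * t))
      ((s * √(2 * t) - (s * t + c) * (1 / √(2 * t))) / √(2 * t) ^ 2) t := by
    convert! (((hasDerivAt_id t).const_mul s).add_const c).div hdr hr.ne' using 1
    simp
  have h1 := (hasDerivAt_integral_exp_neg_sq ((s * t + -x) / √(2 * t))).comp t (hd (-x))
  have h2 := (hasDerivAt_integral_exp_neg_sq ((s * t + x) / √(2 * t))).comp t (hd x)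
  convert! h1.sub (h2.const_mul (exp (2 * s * x))) using 1
  have hexp : exp (2 * s * x) * exp (-((s * t + x) / √(2 * t)) ^ 2) =
      exp (-((s * t + -x) / √(2 * t)) ^ 2) := by
    rw [← exp_add, div_pow, div_pow, hr2]
    congr 1
    field_simp
    ring
  rw [← mul_assoc, hexp, ← sub_eq_add_neg, ← mul_sub]
  congr 1
  field_simp
  ring

theorem tendsto_div_sqrt_atTop {s c : ℝ} (hs : 0 < s) :
    Tendsto (fun t => (s * t + c) / √(2 * t)) atTop atTop := by
  have hsqrt : Tendsto (fun t : ℝ => √(2 * t)) atTop atTop :=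
    tendsto_sqrt_atTop.comp (tendsto_id.const_mul_atTop two_pos)
  have h1 : Tendsto (fun t : ℝ => s / 2 * √(2 * t) + c / √(2 * t)) atTop atTop :=
    (hsqrt.const_mul_atTop (half_pos hs)).atTop_add (hsqrt.const_div_atTop c)
  refine h1.congr' ?_
  filter_upwards [eventually_gt_atTop 0] with t ht
  have hr : 0 < √(2 * t) := by positivity
  have hr2 : √(2 * t) ^ 2 = 2 * t := sq_sqrt (by positivity)
  field_simp
  rw [hr2]
  ring

theorem tendsto_inv_sqrt_nhdsGT_zero : Tendsto (fun t : ℝ => (√(2 * t))⁻¹) (𝓝[>] 0) atTop := by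
  refine tendsto_inv_nhdsGT_zero.comp (tendsto_nhdsWithin_iff.2 ⟨?_, ?_⟩)
  · have : Continuous fun t : ℝ => √(2 * t) := by fun_prop
    simpa using (this.tendsto 0).mono_left nhdsWithin_le_nhds
  · filter_upwards [self_mem_nhdsWithin] with t ht
    have : 0 < t := ht
    exact mem_Ioi.2 (by positivity)

theorem tendsto_affine_nhdsGT_zero (s c : ℝ) :
    Tendsto (fun t : ℝ => s * t + c) (𝓝[>] 0) (𝓝 c) := by
  have : Continuous fun t : ℝ => s * t + c := by fun_prop
  simpa using (this.tendsto 0).mono_left nhdsWithin_le_nhds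

/-- Laplace transform of the first hitting time density of a drifted Brownian motion. -/
theorem laplace_h {q x : ℝ} (μ : ℝ) (hq : 0 < q) (hx : 0 < x) :
    IntegrableOn (fun t => exp (-q * t) * h t x μ) (Ioi 0) ∧
      ∫ t in Ioi 0, exp (-q * t) * h t x μ = exp (-(x * (μ + √(2 * q + μ ^ 2)))) := by
  set s := √(2 * q + μ ^ 2)
  have hs : 0 < s := by positivity
  have hs2 : s ^ 2 = 2 * q + μ ^ 2 := sq_sqrt (by positivity)
  have hcongr : EqOn (fun t => exp (-q * t) * h t x μ) (fun t => exp (-(x * (μ + s))) / √π *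
      (exp (-((s * t - x) / √(2 * t)) ^ 2) * (2 * x / √(2 * t) ^ 3))) (Ioi 0) :=
    fun t ht => exp_mul_h ht hx hs2
  have h0 := ((tendsto_integral_exp_neg_sq_atBot.comp
      ((tendsto_affine_nhdsGT_zero s (-x)).neg_mul_atTop (neg_neg_of_pos hx)
        tendsto_inv_sqrt_nhdsGT_zero)).sub
    ((tendsto_integral_exp_neg_sq_atTop.comp
      ((tendsto_affine_nhdsGT_zero s x).pos_mul_atTop hx
        tendsto_inv_sqrt_nhdsGT_zero)).const_mul (exp (2 * s * x))))
  have hinf := ((tendsto_integral_exp_neg_sq_atTop.comp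
      (tendsto_div_sqrt_atTop (c := -x) hs)).sub
    ((tendsto_integral_exp_neg_sq_atTop.comp
      (tendsto_div_sqrt_atTop (c := x) hs)).const_mul (exp (2 * s * x))))
  obtain ⟨hint, hval⟩ := integrableOn_and_integral_Ioi_of_hasDerivAt_of_nonneg h0
    (fun t (ht : 0 < t) => hasDerivAt_inverseGaussian (s := s) (x := x) ht)
    (fun t _ => by positivity) hinf
  refine ⟨IntegrableOn.congr_fun (hint.const_mul _) hcongr.symm measurableSet_Ioi, ?_⟩
  rw [setIntegral_congr_fun measurableSet_Ioi hcongr, integral_const_mul, hval]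
  field_simp
  ring

theorem measurable_h : Measurable fun p : ℝ × ℝ × ℝ => h p.1 p.2.1 p.2.2 := by
  unfold h
  fun_prop

/-- The exponentially discounted convolution in time of two hitting time densities. -/
theorem exp_mul_integral_h_mul_h (q t x μ z ν : ℝ) :
    exp (-q * t) * ∫ τ in (0 : ℝ)..t, h (t - τ) x μ * h τ z ν =
      ∫ τ in (0 : ℝ)..t, (exp (-q * τ) * h τ z ν) * (exp (-q * (t - τ)) * h (t - τ) x μ) := by
  rw [← intervalIntegral.integral_const_mul]
  congr 1 with τ
  rw [show -q * t = -q * τ + -q * (t - τ) by ring, exp_add]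
  ring

theorem laplace_integral_h_mul_h {q x z : ℝ} (μ ν : ℝ) (hq : 0 < q) (hx : 0 < x) (hz : 0 < z) :
    IntegrableOn (fun t => exp (-q * t) * ∫ τ in (0 : ℝ)..t, h (t - τ) x μ * h τ z ν) (Ioi 0) ∧
      ∫ t in Ioi 0, exp (-q * t) * ∫ τ in (0 : ℝ)..t, h (t - τ) x μ * h τ z ν =
        exp (-(z * (ν + √(2 * q + ν ^ 2))) - x * (μ + √(2 * q + μ ^ 2))) := by
  obtain ⟨hi, hv⟩ := laplace_h μ hq hx
  obtain ⟨hi', hv'⟩ := laplace_h ν hq hz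
  simp_rw [exp_mul_integral_h_mul_h]
  constructor
  · have := integrable_posConvolution hi' hi (ContinuousLinearMap.mul ℝ ℝ)
    rwa [posConvolution, integrable_indicator_iff measurableSet_Ioi] at this
  · have := integral_posConvolution hi' hi (ContinuousLinearMap.mul ℝ ℝ)
    simp only [ContinuousLinearMap.mul_apply'] at this
    rw [this, hv, hv', ← exp_add]
    ring_nf

theorem aestronglyMeasurable_exp_mul_integral_h_mul_h (β μ ν q y : ℝ) :
    AEStronglyMeasurable (fun p : ℝ × ℝ => exp (-q * p.1) *
        ∫ τ in (0 : ℝ)..p.1, h (p.1 - τ) ((1 + β) * p.2 + y) μ * h τ ((1 - β) * p.2) ν)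
      ((volume.restrict (Ioi 0)).prod (volume.restrict (Ioi 0))) := by
  have hmeas : Measurable fun r : (ℝ × ℝ) × ℝ =>
      {r : (ℝ × ℝ) × ℝ | 0 < r.2 ∧ r.2 ≤ r.1.1}.indicator
        (fun r => h (r.1.1 - r.2) ((1 + β) * r.1.2 + y) μ * h r.2 ((1 - β) * r.1.2) ν) r := by
    refine Measurable.indicator ?_ ?_
    · exact (measurable_h.comp (g := fun p : ℝ × ℝ × ℝ => h p.1 p.2.1 p.2.2)
        (f := fun r : (ℝ × ℝ) × ℝ => (r.1.1 - r.2, (1 + β) * r.1.2 + y, μ)) (by fun_prop)).mul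
        (measurable_h.comp (g := fun p : ℝ × ℝ × ℝ => h p.1 p.2.1 p.2.2)
        (f := fun r : (ℝ × ℝ) × ℝ => (r.2, (1 - β) * r.1.2, ν)) (by fun_prop))
    · exact (measurableSet_lt measurable_const measurable_snd).inter
        (measurableSet_le measurable_snd (measurable_fst.comp measurable_fst))
  have hexp : Measurable fun p : ℝ × ℝ => exp (-q * p.1) := by fun_prop
  refine (hexp.aestronglyMeasurable.mul (hmeas.stronglyMeasurable.integral_prod_right'
    (ν := volume)).aestronglyMeasurable).congr ?_
  rw [Measure.prod_restrict]
  filter_upwards [ae_restrict_mem (measurableSet_Ioi.prod measurableSet_Ioi)] with p hp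
  simp only [Pi.mul_apply]
  rw [intervalIntegral.integral_of_le (le_of_lt hp.1), ← integral_indicator measurableSet_Ioc]
  rfl

/-- Laplace transform (in time) of the transition density of refracted skew Brownian
motion started at 0, for `y > 0`. -/
theorem laplace_transition_density_pos (β μp μm q y : ℝ)
    (hβ : β ∈ Ioo (-1 : ℝ) 1) (hq : 0 < q) (hy : 0 < y) :
    ∫ t in Ioi (0 : ℝ), Real.exp (-q * t) *
        (2 * (1 + β) * Real.exp (2 * μp * y) *
          ∫ b in Ioi (0 : ℝ), ∫ τ in (0 : ℝ)..t,
            h (t - τ) ((1 + β) * b + y) μp * h τ ((1 - β) * b) (-μm))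
      = 2 * (1 + β) / D β μp μm q * Real.exp ((μp - Real.sqrt (2 * q + μp ^ 2)) * y) := by
  have hβ1 : 0 < 1 + β := by linarith [hβ.1]
  have hβ2 : 0 < 1 - β := by linarith [hβ.2]
  have hpos (μ : ℝ) : 0 < μ + √(2 * q + μ ^ 2) := by
    have : |μ| < √(2 * q + μ ^ 2) := by
      rw [← sqrt_sq_eq_abs]
      exact sqrt_lt_sqrt (sq_nonneg _) (by linarith)
    linarith [neg_abs_le μ]
  have hD : 0 < D β μp μm q := by
    have h1 := hpos μp
    have h2 := hpos (-μm)
    rw [neg_sq] at h2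
    unfold D
    positivity
  set F : ℝ → ℝ → ℝ := fun t b => exp (-q * t) *
    ∫ τ in (0 : ℝ)..t, h (t - τ) ((1 + β) * b + y) μp * h τ ((1 - β) * b) (-μm) with hF
  have hFnn {t b : ℝ} (ht : 0 < t) : 0 ≤ F t b :=
    mul_nonneg (exp_pos _).le <| intervalIntegral.integral_nonneg ht.le fun _ _ =>
      mul_nonneg (h_nonneg _ _ _) (h_nonneg _ _ _)
  have hlap {b : ℝ} (hb : 0 < b) := laplace_integral_h_mul_h (x := (1 + β) * b + y)
    (z := (1 - β) * b) μp (-μm) hq (by positivity) (by positivity)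
  have hval : EqOn (fun b => ∫ t in Ioi 0, F t b)
      (fun b => exp (-(y * (μp + √(2 * q + μp ^ 2)))) * exp (-D β μp μm q * b)) (Ioi 0) := by
    intro b hb
    refine (hlap hb).2.trans ?_
    simp only [← exp_add, neg_sq, D]
    ring_nf
  have hexp := integrableOn_exp_mul_Ioi (neg_lt_zero.2 hD) 0
  have hint : Integrable (Function.uncurry F)
      ((volume.restrict (Ioi 0)).prod (volume.restrict (Ioi 0))) := by
    refine (integrable_prod_iff' (aestronglyMeasurable_exp_mul_integral_h_mul_h β μp (-μm) q y)).2 ⟨?_, ?_⟩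
    · filter_upwards [ae_restrict_mem measurableSet_Ioi] with b hb using (hlap hb).1
    · refine (IntegrableOn.congr_fun (hexp.const_mul _) hval.symm measurableSet_Ioi).congr ?_
      refine ae_of_all _ fun b => setIntegral_congr_fun measurableSet_Ioi fun t ht => ?_
      exact (norm_of_nonneg (hFnn ht)).symm
  calc _ = ∫ t in Ioi 0, 2 * (1 + β) * exp (2 * μp * y) * ∫ b in Ioi 0, F t b := by
        refine integral_congr_ae (ae_of_all _ fun t => ?_)
        simp only [hF]
        rw [integral_const_mul]
        ring
    _ = 2 * (1 + β) * exp (2 * μp * y) *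
        (exp (-(y * (μp + √(2 * q + μp ^ 2)))) * (1 / D β μp μm q)) := by
        rw [integral_const_mul, integral_integral_swap hint,
          setIntegral_congr_fun measurableSet_Ioi hval, integral_const_mul,
          integral_exp_mul_Ioi (neg_lt_zero.2 hD)]
        simp [neg_div_neg_eq]
    _ = _ := by
        rw [show (μp - √(2 * q + μp ^ 2)) * y =
          2 * μp * y + -(y * (μp + √(2 * q + μp ^ 2))) by ring, exp_add]
        ring
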